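/- arXiv:2603.16170 — 2 statements merged into one kernel-verified Lean document; each statement's English description precedes it below -/
import Mathlib

section
/- Taking β = α+4 in the sharp multiplier norm formula: for α > -1, the multiplication operator by S(κ)(z) = -6/(1-z²)² from A²_α to A²_{α+4} has norm squared equal to 36(α+3)(α+5)/((α+2)(α+4)). -/
open MeasureTheory Complex Real

/-- The square of the weighted Bergman norm on the unit disk. -/
noncomputable def bergmanNormSq (α : ℝ) (φ : ℂ → ℂ) : ℝ :=
  (α + 1) / π * ∫ z in Metric.ball (0 : ℂ) 1, ‖φ z‖ ^ 2 * (1 - ‖z‖ ^ 2) ^ α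

/-- Membership in the weighted Bergman space `A²_α`. -/
def MemBergman (α : ℝ) (φ : ℂ → ℂ) : Prop :=
  DifferentiableOn ℂ φ (Metric.ball (0 : ℂ) 1) ∧
    IntegrableOn (fun z : ℂ => ‖φ z‖ ^ 2 * (1 - ‖z‖ ^ 2) ^ α) (Metric.ball (0 : ℂ) 1)

/-- The square of the multiplier norm of `g` from `A²_α` to `A²_β`. -/
noncomputable def multNormSq (α β : ℝ) (g : ℂ → ℂ) : ℝ :=
  sSup {t : ℝ | ∃ φ : ℂ → ℂ, MemBergman α φ ∧ bergmanNormSq α φ ≠ 0 ∧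
    t = bergmanNormSq β (fun z => g z * φ z) / bergmanNormSq α φ}


lemma circ_parseval (c : ℕ → ℂ) (e : ℕ → ℕ) (he : Function.Injective e)
    (hc : Summable fun n => ‖c n‖) (f : ℝ → ℂ)
    (hf : ∀ θ : ℝ, HasSum (fun n => c n * Complex.exp ((e n : ℂ) * (θ * I))) (f θ)) :
    ∫⁻ θ in Set.Ioo (-π) π, ENNReal.ofReal (‖f θ‖ ^ 2) =
      ENNReal.ofReal (2 * π) * ∑' n, ENNReal.ofReal (‖c n‖ ^ 2) := by
  let F : ℕ × ℕ → ℝ → ℂ := fun p θ => (c p.1 * Complex.exp ((e p.1 : ℂ) * (θ * I))) *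
    (starRingEnd ℂ) (c p.2 * Complex.exp ((e p.2 : ℂ) * (θ * I)))
  have hnorm : ∀ n (θ : ℝ), ‖c n * Complex.exp ((e n : ℂ) * (θ * I))‖ = ‖c n‖ := by
    intro n θ
    have : (e n : ℂ) * (θ * I) = ((e n * θ : ℝ) : ℂ) * I := by push_cast; ring
    rw [norm_mul, this, Complex.norm_exp_ofReal_mul_I, mul_one]
  have hFn : ∀ p θ, ‖F p θ‖ = ‖c p.1‖ * ‖c p.2‖ := by
    intro p θ
    simp only [F]
    rw [norm_mul, RCLike.norm_conj, hnorm, hnorm]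
  have hFc : ∀ p, Continuous (F p) := by
    intro p
    simp only [F]
    fun_prop
  have hsum : ∀ θ, HasSum (fun p => F p θ) ((‖f θ‖ ^ 2 : ℝ) : ℂ) := by
    intro θ
    have h1 := hf θ
    have h2 : HasSum (fun n => (starRingEnd ℂ) (c n * Complex.exp ((e n : ℂ) * (θ * I))))
      ((starRingEnd ℂ) (f θ)) := Complex.hasSum_conj'.2 h1
    have s1 : Summable fun n => ‖c n * Complex.exp ((e n : ℂ) * (θ * I))‖ := by
      simpa only [hnorm] using hc
    have s2 : Summable fun n =>
        ‖(starRingEnd ℂ) (c n * Complex.exp ((e n : ℂ) * (θ * I)))‖ := by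
      simpa only [RCLike.norm_conj, hnorm] using hc
    have s3 := summable_mul_of_summable_norm s1 s2
    have h3 := HasSum.mul h1 h2 s3
    have h4 : ((‖f θ‖ ^ 2 : ℝ) : ℂ) = f θ * (starRingEnd ℂ) (f θ) := by
      rw [Complex.mul_conj']; push_cast; rfl
    rw [h4]
    exact h3
  have hintg : HasSum (fun p => ∫ θ in Set.Ioo (-π) π, F p θ)
      (∫ θ in Set.Ioo (-π) π, ∑' p, F p θ) := by
    apply hasSum_integral_of_summable_integral_norm
    · intro p
      exact ((hFc p).integrableOn_Icc).mono_set Set.Ioo_subset_Icc_self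
    · simp only [hFn, integral_const, smul_eq_mul]
      exact (hc.mul_of_nonneg hc (fun _ => norm_nonneg _) (fun _ => norm_nonneg _)).mul_left _
  have hval : ∀ p : ℕ × ℕ, ∫ θ in Set.Ioo (-π) π, F p θ =
      if p.1 = p.2 then ((2 * π * ‖c p.1‖ ^ 2 : ℝ) : ℂ) else 0 := by
    rintro ⟨n, m⟩
    rw [← integral_Ioc_eq_integral_Ioo,
      ← intervalIntegral.integral_of_le (by linarith [Real.pi_pos])]
    have hF : ∀ θ : ℝ, F (n, m) θ = (c n * (starRingEnd ℂ) (c m)) *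
        Complex.exp ((((e n : ℂ) - e m) * I) * θ) := by
      intro θ
      simp only [F, map_mul, ← Complex.exp_conj, Complex.conj_ofReal, Complex.conj_I,
        Complex.conj_natCast]
      rw [show (((e n : ℂ) - e m) * I) * θ = (e n : ℂ) * (θ * I) + (e m : ℂ) * (θ * -I) by ring,
        Complex.exp_add]
      ring
    simp only [hF, intervalIntegral.integral_const_mul]
    split_ifs with h
    · subst h
      simp only [sub_self, zero_mul, Complex.exp_zero, intervalIntegral.integral_const,
        Complex.mul_conj']
      push_cast
      simp
      ring
    · have hne : ((e n : ℂ) - e m) * I ≠ 0 := by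
        refine mul_ne_zero (sub_ne_zero.2 ?_) Complex.I_ne_zero
        exact_mod_cast fun hh => h (he hh)
      rw [integral_exp_mul_complex hne]
      have : Complex.exp (((e n : ℂ) - e m) * I * (π : ℝ)) =
          Complex.exp (((e n : ℂ) - e m) * I * ((-π : ℝ) : ℂ)) := by
        rw [Complex.exp_eq_exp_iff_exists_int]
        refine ⟨(e n : ℤ) - e m, ?_⟩
        push_cast
        ring
      rw [this]; simp
  have hdiag : HasSum (fun n => ((2 * π * ‖c n‖ ^ 2 : ℝ) : ℂ))
      (∫ θ in Set.Ioo (-π) π, ∑' p, F p θ) := by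
    have hinj : Function.Injective (fun n : ℕ => (n, n)) := fun a b h => (Prod.mk.inj h).1
    have := (hinj.hasSum_iff (f := fun p : ℕ × ℕ => ∫ θ in Set.Ioo (-π) π, F p θ)
      (a := ∫ θ in Set.Ioo (-π) π, ∑' p, F p θ) ?_).2 hintg
    · simpa only [Function.comp_def, hval, if_true] using this
    · rintro ⟨n, m⟩ hnm
      rw [hval, if_neg]
      intro hh
      exact hnm ⟨n, Prod.ext rfl hh⟩
  simp only [(hsum _).tsum_eq] at hdiag
  have hio : (∫ θ in Set.Ioo (-π) π, ((‖f θ‖ ^ 2 : ℝ) : ℂ)) =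
      ((∫ θ in Set.Ioo (-π) π, ‖f θ‖ ^ 2 : ℝ) : ℂ) := integral_ofReal
  rw [hio] at hdiag
  have hd2 := Complex.hasSum_ofReal.1 hdiag
  have hfint : IntegrableOn (fun θ => ‖f θ‖ ^ 2) (Set.Ioo (-π) π) := by
    have hcont : Continuous f := by
      have : f = fun θ : ℝ => ∑' n, c n * Complex.exp ((e n : ℂ) * (θ * I)) :=
        funext fun θ => (hf θ).tsum_eq.symm
      rw [this]
      exact continuous_tsum (fun n => by fun_prop) hc (fun n θ => (hnorm n θ).le)
    exact ((hcont.norm.pow 2).integrableOn_Icc).mono_set Set.Ioo_subset_Icc_self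
  rw [← ofReal_integral_eq_lintegral_ofReal hfint (Filter.Eventually.of_forall fun θ => by positivity),
    ← hd2.tsum_eq, ENNReal.ofReal_tsum_of_nonneg (fun n => by positivity) hd2.summable,
    ← ENNReal.tsum_mul_left]
  congr 1; ext n
  rw [ENNReal.ofReal_mul (by positivity)]

/-- Beta weights. -/
noncomputable def bV (a : ℝ) : ℕ → ℝ
  | 0 => 1 / (a + 1)
  | (n + 1) => bV a n * ((n + 1) / (n + a + 2))

lemma bV_succ (a : ℝ) (n : ℕ) : bV a (n + 1) = bV a n * ((n + 1) / (n + a + 2)) := rfl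

lemma bV_pos (a : ℝ) (ha : -1 < a) (n : ℕ) : 0 < bV a n := by
  induction n with
  | zero => simp only [bV]; apply div_pos <;> linarith
  | succ n ih => rw [bV_succ]; have : (0:ℝ) ≤ n := n.cast_nonneg
                 apply mul_pos ih; apply div_pos <;> linarith

lemma radial_integrable (a : ℝ) (ha : -1 < a) (n : ℕ) :
    IntervalIntegrable (fun r : ℝ => 2 * r ^ (2 * n + 1) * (1 - r ^ 2) ^ a) volume 0 1 ∧
    (∫ r in (0:ℝ)..1, 2 * r ^ (2 * n + 1) * (1 - r ^ 2) ^ a) = bV a n := by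
  have hder : ∀ r ∈ Set.Ioo (0:ℝ) 1, HasDerivAt (fun r : ℝ => (1 - r ^ 2) ^ (a + 1))
      (-(2 * (a + 1) * r * (1 - r ^ 2) ^ a)) r := by
    intro r hr
    have h1 : 0 < 1 - r ^ 2 := by nlinarith [hr.1, hr.2]
    have h := (hasDerivAt_pow 2 r).const_sub 1
    have h2 := h.rpow_const (p := a + 1) (Or.inl (by simpa using h1.ne'))
    convert h2 using 1
    rw [add_sub_cancel_right]
    push_cast
    ring
  have hcont : ContinuousOn (fun r : ℝ => (1 - r ^ 2) ^ (a + 1)) (Set.Icc 0 1) :=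
    ContinuousOn.rpow_const (by fun_prop) (fun x _ => Or.inr (by linarith))
  have hintg : ∀ n : ℕ,
      IntervalIntegrable (fun r : ℝ => 2 * r ^ (2 * n + 1) * (1 - r ^ 2) ^ a) volume 0 1 := by
    have h0 : IntervalIntegrable (fun r : ℝ => r * (1 - r ^ 2) ^ a) volume 0 1 := by
      rw [intervalIntegrable_iff_integrableOn_Ioc_of_le zero_le_one]
      have := intervalIntegral.integrableOn_deriv_of_nonneg (a := 0) (b := 1)
        (g := fun r : ℝ => -(1 - r ^ 2) ^ (a + 1))
        (g' := fun r => (2 * (a + 1) * r * (1 - r ^ 2) ^ a)) hcont.neg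
        (fun r hr => by have := (hder r hr).neg; rw [neg_neg] at this; exact this) (fun r hr => by
          have h1 : 0 < 1 - r ^ 2 := by nlinarith [hr.1, hr.2]
          have := hr.1
          have : 0 < a + 1 := by linarith
          positivity)
      have := this.const_mul (1 / (2 * (a + 1)))
      refine this.congr (Filter.Eventually.of_forall fun r => ?_)
      have : a + 1 ≠ 0 := by linarith
      simp only
      field_simp
    intro n
    have := h0.continuousOn_mul (g := fun r : ℝ => 2 * r ^ (2 * n)) (by fun_prop)
    refine this.congr fun r _ => ?_
    ring
  refine ⟨hintg n, ?_⟩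
  induction n with
  | zero =>
    have := intervalIntegral.integral_eq_sub_of_hasDerivAt_of_le zero_le_one hcont hder (by
      have := (hintg 0).const_mul (-(a + 1))
      refine this.congr fun r _ => ?_
      ring)
    have h2 : (∫ r in (0:ℝ)..1, -(2 * (a + 1) * r * (1 - r ^ 2) ^ a)) =
        -(a + 1) * ∫ r in (0:ℝ)..1, 2 * r ^ (2 * 0 + 1) * (1 - r ^ 2) ^ a := by
      rw [← intervalIntegral.integral_const_mul]
      congr 1; ext r; ring
    rw [h2] at this
    have h3 : a + 1 ≠ 0 := by linarith
    simp [Real.zero_rpow h3] at this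
    simp only [bV]
    field_simp
    simp
    linarith
  | succ n ih =>
    have hd : ∀ r ∈ Set.Ioo (0:ℝ) 1, HasDerivAt (fun r : ℝ => r ^ (2 * n + 2) * (1 - r ^ 2) ^ (a + 1))
        ((n + 1) * (2 * r ^ (2 * n + 1) * (1 - r ^ 2) ^ a) -
          (n + a + 2) * (2 * r ^ (2 * (n + 1) + 1) * (1 - r ^ 2) ^ a)) r := by
      intro r hr
      have h1 : 0 < 1 - r ^ 2 := by nlinarith [hr.1, hr.2]
      have h := (hasDerivAt_pow (2 * n + 2) r).mul (hder r hr)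
      refine HasDerivAt.congr_deriv h ?_
      rw [Real.rpow_add_one h1.ne', show 2 * n + 2 - 1 = 2 * n + 1 by omega]
      push_cast
      ring
    have := intervalIntegral.integral_eq_sub_of_hasDerivAt_of_le zero_le_one
      (ContinuousOn.mul (by fun_prop) hcont) hd
      (((hintg n).const_mul _).sub ((hintg (n+1)).const_mul _))
    rw [intervalIntegral.integral_sub ((hintg n).const_mul _) ((hintg (n+1)).const_mul _),
      intervalIntegral.integral_const_mul, intervalIntegral.integral_const_mul, ih] at this
    have h3 : a + 1 ≠ 0 := by linarith
    have h4 : (n:ℝ) + a + 2 ≠ 0 := by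
      have : (0:ℝ) ≤ n := n.cast_nonneg
      linarith
    simp [Real.zero_rpow h3] at this
    rw [bV_succ]
    field_simp
    simp only [mul_add, mul_one] at this ⊢
    linarith

lemma radial_lintegral (a : ℝ) (ha : -1 < a) (n : ℕ) :
    ∫⁻ r in Set.Ioo (0:ℝ) 1, ENNReal.ofReal (2 * r ^ (2 * n + 1) * (1 - r ^ 2) ^ a) =
      ENNReal.ofReal (bV a n) := by
  obtain ⟨h1, h2⟩ := radial_integrable a ha n
  rw [intervalIntegrable_iff_integrableOn_Ioo_of_le zero_le_one] at h1
  rw [intervalIntegral.integral_of_le zero_le_one, integral_Ioc_eq_integral_Ioo] at h2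
  rw [← h2, ofReal_integral_eq_lintegral_ofReal h1]
  filter_upwards [ae_restrict_mem measurableSet_Ioo] with r hr
  have h1 : 0 < 1 - r ^ 2 := by nlinarith [hr.1, hr.2]
  have := hr.1
  simp only [Pi.zero_apply]
  positivity

lemma disc_parseval (a : ℝ) (ha : -1 < a) (c : ℕ → ℂ) (e : ℕ → ℕ) (he : Function.Injective e)
    (φ : ℂ → ℂ) (hcont : ContinuousOn φ (Metric.ball (0 : ℂ) 1))
    (hφ : ∀ z ∈ Metric.ball (0 : ℂ) 1, HasSum (fun n => c n * z ^ (e n)) (φ z)) :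
    ∫⁻ z in Metric.ball (0 : ℂ) 1, ENNReal.ofReal (‖φ z‖ ^ 2 * (1 - ‖z‖ ^ 2) ^ a) =
      ENNReal.ofReal π * ∑' n, ENNReal.ofReal (‖c n‖ ^ 2 * bV a (e n)) := by
  let g : ℝ × ℝ → ℂ := fun p => (p.1 : ℂ) * Complex.exp (p.2 * I)
  have hg : ∀ p, Complex.polarCoord.symm p = g p := by
    intro p
    rw [Complex.polarCoord_symm_apply]
    simp only [g]
    rw [Complex.exp_mul_I]
    push_cast
    rfl
  have hgn : ∀ r θ : ℝ, 0 < r → ‖g (r, θ)‖ = r := by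
    intro r θ hr
    simp only [g]
    rw [norm_mul, Complex.norm_exp_ofReal_mul_I, mul_one, Complex.norm_real, Real.norm_eq_abs,
      abs_of_pos hr]
  let S : Set (ℝ × ℝ) := Set.Ioo (0:ℝ) 1 ×ˢ Set.Ioo (-π) π
  have hS : MeasurableSet S := measurableSet_Ioo.prod measurableSet_Ioo
  have hgc : Continuous g := by simp only [g]; fun_prop
  have hmaps : Set.MapsTo g S (Metric.ball 0 1) := by
    rintro ⟨r, θ⟩ ⟨hr, hθ⟩
    rw [mem_ball_zero_iff, hgn r θ hr.1]
    exact hr.2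
  let G : ℝ × ℝ → ENNReal := fun p =>
    ENNReal.ofReal (p.1 * (‖φ (g p)‖ ^ 2 * (1 - p.1 ^ 2) ^ a))
  have hstep_one : ∫⁻ z in Metric.ball (0 : ℂ) 1, ENNReal.ofReal (‖φ z‖ ^ 2 * (1 - ‖z‖ ^ 2) ^ a) =
      ∫⁻ p in S, G p := by
    rw [← lintegral_indicator Metric.isOpen_ball.measurableSet,
      ← Complex.lintegral_comp_polarCoord_symm, ← lintegral_indicator hS,
      ← lintegral_indicator (polarCoord.open_target.measurableSet)]
    congr 1
    ext ⟨r, θ⟩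
    simp only [hg]
    rw [polarCoord_target]
    by_cases h1 : 0 < r ∧ θ ∈ Set.Ioo (-π) π
    · rw [Set.indicator_of_mem (show (r, θ) ∈ Set.Ioi (0:ℝ) ×ˢ Set.Ioo (-π) π from h1)]
      by_cases h2 : r < 1
      · rw [Set.indicator_of_mem (show (r, θ) ∈ S from ⟨⟨h1.1, h2⟩, h1.2⟩),
          Set.indicator_of_mem (show g (r, θ) ∈ Metric.ball (0:ℂ) 1 from
            hmaps (show (r, θ) ∈ S from ⟨⟨h1.1, h2⟩, h1.2⟩))]
        simp only [G, smul_eq_mul]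
        rw [ENNReal.ofReal_mul h1.1.le, hgn r θ h1.1]
      · rw [Set.indicator_of_notMem (show (r, θ) ∉ S from fun h => h2 h.1.2),
          Set.indicator_of_notMem (by rw [mem_ball_zero_iff, hgn r θ h1.1]; exact h2), smul_zero]
    · rw [Set.indicator_of_notMem (show (r, θ) ∉ Set.Ioi (0:ℝ) ×ˢ Set.Ioo (-π) π from
          fun h => h1 ⟨h.1, h.2⟩),
        Set.indicator_of_notMem (show (r, θ) ∉ S from fun h => h1 ⟨h.1.1, h.2⟩)]
  have hGm : AEMeasurable G (volume.restrict S) := by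
    refine (ContinuousOn.aemeasurable ?_ hS).ennreal_ofReal
    refine ContinuousOn.mul (by fun_prop) (ContinuousOn.mul ?_ ?_)
    · exact ((hcont.comp hgc.continuousOn hmaps).norm.pow 2)
    · refine ContinuousOn.rpow_const (by fun_prop) ?_
      rintro ⟨r, θ⟩ ⟨hr, hθ⟩
      left
      have h1 : 0 < 1 - r ^ 2 := by nlinarith [hr.1, hr.2]
      exact h1.ne'
  have hprod : (volume : Measure (ℝ × ℝ)).restrict S =
      (volume.restrict (Set.Ioo (0:ℝ) 1)).prod (volume.restrict (Set.Ioo (-π) π)) := by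
    rw [Measure.prod_restrict]; rfl
  rw [hstep_one, hprod, lintegral_prod _ (by rw [← hprod]; exact hGm)]
  have hstep_two : ∀ r ∈ Set.Ioo (0:ℝ) 1, ∫⁻ θ in Set.Ioo (-π) π, G (r, θ) =
      ∑' n, ENNReal.ofReal (π * ‖c n‖ ^ 2) *
        ENNReal.ofReal (2 * r ^ (2 * e n + 1) * (1 - r ^ 2) ^ a) := by
    intro r hr
    have h0 := hr.1
    have h1 : 0 < 1 - r ^ 2 := by nlinarith [hr.1, hr.2]
    have hw : 0 ≤ r * (1 - r ^ 2) ^ a := by positivity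
    have hGr : ∀ θ, G (r, θ) = ENNReal.ofReal (r * (1 - r ^ 2) ^ a) *
        ENNReal.ofReal (‖φ (g (r, θ))‖ ^ 2) := by
      intro θ
      rw [← ENNReal.ofReal_mul hw]
      simp only [G]
      congr 1; ring
    have hzball : (r : ℂ) ∈ Metric.ball (0:ℂ) 1 := by
      rw [mem_ball_zero_iff, Complex.norm_real, Real.norm_eq_abs, abs_of_pos h0]; exact hr.2
    have hcs : Summable fun n => ‖c n * (r : ℂ) ^ e n‖ := (hφ r hzball).summable.norm
    have hp := circ_parseval (fun n => c n * (r : ℂ) ^ e n) e he hcs (fun θ => φ (g (r, θ))) (by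
      intro θ
      have := hφ (g (r, θ)) (by rw [mem_ball_zero_iff, hgn r θ h0]; exact hr.2)
      have hfe : (fun n => c n * (r : ℂ) ^ e n * Complex.exp ((e n : ℂ) * (θ * I))) =
          fun n => c n * g (r, θ) ^ e n := by
        funext n
        simp only [g]
        rw [mul_pow, ← Complex.exp_nat_mul, mul_assoc]
      rw [hfe]
      exact this)
    simp only [hGr]
    rw [lintegral_const_mul' _ _ ENNReal.ofReal_ne_top, hp, ← ENNReal.tsum_mul_left,
      ← ENNReal.tsum_mul_left]
    congr 1; ext n
    rw [← ENNReal.ofReal_mul (by positivity), ← ENNReal.ofReal_mul (by positivity),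
      ← ENNReal.ofReal_mul (by positivity)]
    congr 1
    rw [norm_mul, norm_pow, Complex.norm_real, Real.norm_eq_abs, abs_of_pos h0]
    ring
  rw [setLIntegral_congr_fun measurableSet_Ioo hstep_two]
  rw [lintegral_tsum]
  · rw [← ENNReal.tsum_mul_left]
    congr 1; ext n
    rw [lintegral_const_mul' _ _ ENNReal.ofReal_ne_top, radial_lintegral a ha,
      ← ENNReal.ofReal_mul (by positivity), ← ENNReal.ofReal_mul (by positivity)]
    congr 1; ring
  · intro n
    refine AEMeasurable.const_mul ?_ _
    exact (((by fun_prop : Measurable fun r : ℝ => 2 * r ^ (2 * e n + 1) * (1 - r ^ 2) ^ a))).ennreal_ofReal.aemeasurable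

lemma bV_rel2 (a : ℝ) (ha : -1 < a) (n : ℕ) :
    (a + 2) * (a + 1) * bV a (n + 1) = bV (a + 2) n * ((n + 1) * (n + a + 3)) := by
  induction n with
  | zero =>
    have h1 : a + 1 ≠ 0 := by linarith
    have h2 : a + 2 ≠ 0 := by linarith
    have h3 : a + 3 ≠ 0 := by linarith
    have h4 : a + 2 + 1 ≠ 0 := by linarith
    simp only [bV]
    push_cast
    simp only [zero_add]
    field_simp
    ring
  | succ n ih =>
    have hn : (0:ℝ) ≤ n := n.cast_nonneg
    have h3 : (n:ℝ) + a + 3 ≠ 0 := by linarith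
    have h4 : (n:ℝ) + 1 + a + 2 ≠ 0 := by linarith
    have h5 : (n:ℝ) + (a + 2) + 2 ≠ 0 := by linarith
    rw [bV_succ a (n+1), bV_succ (a+2) n, ← mul_assoc, ih]
    push_cast
    field_simp
    ring

lemma bV_rel4 (a : ℝ) (ha : -1 < a) (n : ℕ) :
    bV (a + 2) n * ((n + a + 2) * (n + a + 3)) = (a + 1) * (a + 2) * bV a n := by
  have hn : (0:ℝ) ≤ n := n.cast_nonneg
  have h := bV_rel2 a ha n
  rw [bV_succ] at h
  have h4 : (n:ℝ) + a + 2 ≠ 0 := by linarith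
  have h5 : (n:ℝ) + 1 ≠ 0 := by linarith
  field_simp at h
  linarith

lemma norm_ineq (x y : ℂ) (m p : ℝ) :
    (p - m) * (m * ‖x‖ ^ 2 - p * ‖y‖ ^ 2) ≤ m * p * ‖x - y‖ ^ 2 := by
  rw [Complex.sq_norm, Complex.sq_norm, Complex.sq_norm, Complex.normSq_apply,
    Complex.normSq_apply, Complex.normSq_apply, Complex.sub_re, Complex.sub_im]
  nlinarith [sq_nonneg (m * x.re - p * y.re), sq_nonneg (m * x.im - p * y.im)]

/-- Discrete Hardy step. -/
lemma hardy_step (a : ℝ) (ha : -1 < a) (b : ℕ → ℂ) (N : ℕ) :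
    (a + 2) ^ 2 * ∑ n ∈ Finset.range N, ‖b n‖ ^ 2 * bV (a + 2) n ≤
      (a + 2) * (a + 1) * (‖b 0‖ ^ 2 * bV a 0 + ‖b 1‖ ^ 2 * bV a 1 +
        ∑ n ∈ Finset.range N, ‖b (n + 2) - b n‖ ^ 2 * bV a (n + 2)) := by
  have key : ∀ N : ℕ, (a + 2) ^ 2 * ∑ n ∈ Finset.range N, ‖b n‖ ^ 2 * bV (a + 2) n
      + (a + 2) * ((N + a + 3) * bV (a + 2) N * ‖b N‖ ^ 2)
      + (a + 2) * ((N + 1 + a + 3) * bV (a + 2) (N + 1) * ‖b (N + 1)‖ ^ 2) ≤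
      (a + 2) * (a + 1) * (‖b 0‖ ^ 2 * bV a 0 + ‖b 1‖ ^ 2 * bV a 1 +
        ∑ n ∈ Finset.range N, ‖b (n + 2) - b n‖ ^ 2 * bV a (n + 2)) := by
    intro N
    induction N with
    | zero =>
      have e0 := bV_rel4 a ha 0
      have e1 := bV_rel4 a ha 1
      have p1 := bV_pos (a+2) (by linarith) 1
      simp only [Finset.range_zero, Finset.sum_empty, mul_zero, add_zero, zero_add]
      push_cast at *
      have e2 : (a + 2) * (a + 1) * (‖b 0‖ ^ 2 * bV a 0 + ‖b 1‖ ^ 2 * bV a 1) =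
        ‖b 0‖ ^ 2 * ((a + 1) * (a + 2) * bV a 0) + ‖b 1‖ ^ 2 * ((a + 1) * (a + 2) * bV a 1) := by
        ring
      rw [e2, ← e0, ← e1]
      have h4 : 0 < a + 4 := by linarith
      have : 0 ≤ ‖b 1‖ ^ 2 * bV (a + 2) 1 * (a + 4) := by positivity
      nlinarith
    | succ N ih =>
      rw [Finset.sum_range_succ, Finset.sum_range_succ]
      have hN : (0:ℝ) ≤ N := N.cast_nonneg
      have e1 := bV_rel2 a ha (N + 1)
      have p1 := bV_pos (a+2) (by linarith) (N + 1)
      have r1 : bV (a + 2) (N + 1) * (N + a + 4) = bV (a + 2) N * (N + 1) := by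
        rw [bV_succ]
        have : (N:ℝ) + (a + 2) + 2 ≠ 0 := by linarith
        field_simp
        ring
      have r2 : bV (a + 2) (N + 2) * (N + a + 5) = bV (a + 2) (N + 1) * (N + 2) := by
        rw [bV_succ (a + 2) (N + 1)]
        have : ((N + 1 : ℕ) : ℝ) + (a + 2) + 2 ≠ 0 := by push_cast; linarith
        field_simp
        push_cast
        ring
      have hI := mul_le_mul_of_nonneg_left
        (norm_ineq (b (N + 2)) (b N) (N + 2) (N + a + 4)) p1.le
      push_cast at *
      have e3 : (a + 2) * (a + 1) * (‖b (N + 2) - b N‖ ^ 2 * bV a (N + 2)) =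
          bV (a + 2) (N + 1) * ((N + 2) * (N + a + 4) * ‖b (N + 2) - b N‖ ^ 2) := by
        rw [show (N + 1 + 1 : ℕ) = N + 2 from rfl] at e1
        linear_combination (‖b (N + 2) - b N‖ ^ 2) * e1
      have e4 : bV (a + 2) (N + 1) * (((N + a + 4) - (N + 2)) *
          ((N + 2) * ‖b (N + 2)‖ ^ 2 - (N + a + 4) * ‖b N‖ ^ 2)) =
          (a + 2) * ((N + a + 5) * bV (a + 2) (N + 2) * ‖b (N + 2)‖ ^ 2) -
          (a + 2) * (bV (a + 2) N * (N + 1) * ‖b N‖ ^ 2) := by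
        linear_combination (-(a + 2) * ‖b (N + 2)‖ ^ 2) * r2 - (a + 2) * ‖b N‖ ^ 2 * r1
      rw [e4, ← e3] at hI
      rw [show (N + 1 + 1 : ℕ) = N + 2 from rfl]
      nlinarith
  have hN : (0:ℝ) ≤ N := N.cast_nonneg
  have p0 := bV_pos (a+2) (by linarith) N
  have p1 := bV_pos (a+2) (by linarith) (N + 1)
  have h2 : 0 < a + 2 := by linarith
  have h3 : 0 < N + a + 3 := by linarith
  have h4 : 0 < N + 1 + a + 3 := by linarith
  have t0 : 0 ≤ (a + 2) * ((N + a + 3) * bV (a + 2) N * ‖b N‖ ^ 2) := by positivity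
  have t1 : 0 ≤ (a + 2) * ((N + 1 + a + 3) * bV (a + 2) (N + 1) * ‖b (N + 1)‖ ^ 2) := by positivity
  linarith [key N]

lemma one_sub_sq_ne {z : ℂ} (hz : z ∈ Metric.ball (0:ℂ) 1) : 1 - z ^ 2 ≠ 0 := by
  intro h
  have h1 : z ^ 2 = 1 := by linear_combination -h
  have h2 : ‖z‖ ^ 2 = 1 := by rw [← norm_pow, h1, norm_one]
  rw [mem_ball_zero_iff] at hz
  nlinarith [norm_nonneg z]

lemma diff_div {φ : ℂ → ℂ} (hφ : DifferentiableOn ℂ φ (Metric.ball (0:ℂ) 1)) :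
    DifferentiableOn ℂ (fun z => φ z / (1 - z ^ 2)) (Metric.ball (0:ℂ) 1) :=
  hφ.div (by fun_prop) (fun z hz => one_sub_sq_ne hz)

lemma step_ineq (a : ℝ) (ha : -1 < a) (φ : ℂ → ℂ)
    (hφ : DifferentiableOn ℂ φ (Metric.ball (0:ℂ) 1)) :
    ∫⁻ z in Metric.ball (0 : ℂ) 1,
        ENNReal.ofReal (‖φ z / (1 - z ^ 2)‖ ^ 2 * (1 - ‖z‖ ^ 2) ^ (a + 2)) ≤
      ENNReal.ofReal ((a + 1) / (a + 2)) *
        ∫⁻ z in Metric.ball (0 : ℂ) 1, ENNReal.ofReal (‖φ z‖ ^ 2 * (1 - ‖z‖ ^ 2) ^ a) := by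
  have hψ := diff_div hφ
  set ψ : ℂ → ℂ := fun z => φ z / (1 - z ^ 2) with hψdef
  obtain ⟨b, hb⟩ : ∃ b : ℕ → ℂ, ∀ z ∈ Metric.ball (0:ℂ) 1, HasSum (fun n => b n * z ^ n) (ψ z) := by
    refine ⟨fun n => ((n.factorial : ℂ)⁻¹ * iteratedDeriv n ψ 0), fun z hz => ?_⟩
    have := Complex.hasSum_taylorSeries_on_ball hψ hz
    have hfe : (fun n : ℕ => ((n.factorial : ℂ)⁻¹ * iteratedDeriv n ψ 0) * z ^ n) =
        fun n : ℕ => (n.factorial : ℂ)⁻¹ • (z - 0) ^ n • iteratedDeriv n ψ 0 := by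
      funext n
      simp only [smul_eq_mul, sub_zero]
      ring
    rw [hfe]
    exact this
  let c : ℕ → ℂ := fun n => match n with
    | 0 => b 0
    | 1 => b 1
    | (n + 2) => b (n + 2) - b n
  have hc : ∀ z ∈ Metric.ball (0:ℂ) 1, HasSum (fun n => c n * z ^ n) (φ z) := by
    intro z hz
    have h1 := hb z hz
    have h2 := (hasSum_nat_add_iff' 2).2 h1
    have h3 := h2.sub (h1.mul_left (z ^ 2))
    rw [← hasSum_nat_add_iff' 2]
    have hv : φ z = ψ z - z ^ 2 * ψ z := by
      have := one_sub_sq_ne hz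
      simp only [hψdef]
      field_simp
    convert h3 using 1
    · funext n
      simp only [c]
      ring
    · rw [hv]
      simp [Finset.sum_range_succ, c]
      ring
  rw [disc_parseval (a + 2) (by linarith) b id Function.injective_id ψ hψ.continuousOn hb,
    disc_parseval a ha c id Function.injective_id φ hφ.continuousOn hc, mul_left_comm]
  gcongr
  rw [ENNReal.tsum_eq_iSup_nat]
  refine iSup_le fun N => ?_
  refine le_trans ?_ (mul_le_mul_right (ENNReal.sum_le_tsum (Finset.range (N + 2))) _)
  have nn : ∀ n, 0 ≤ ‖c n‖ ^ 2 * bV a (id n) := fun n => by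
    have := bV_pos a ha n
    simp only [id]
    positivity
  have nn' : ∀ n, 0 ≤ ‖b n‖ ^ 2 * bV (a + 2) (id n) := fun n => by
    have := bV_pos (a + 2) (by linarith) n
    simp only [id]
    positivity
  have h1 : 0 < a + 1 := by linarith
  have h2 : 0 < a + 2 := by linarith
  rw [← ENNReal.ofReal_sum_of_nonneg (fun n _ => nn n),
    ← ENNReal.ofReal_sum_of_nonneg (fun n _ => nn' n), ← ENNReal.ofReal_mul (by positivity)]
  apply ENNReal.ofReal_le_ofReal
  have := hardy_step a ha b N
  rw [Finset.sum_range_succ', Finset.sum_range_succ']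
  simp only [id, c, zero_add]
  rw [div_mul_eq_mul_div, le_div_iff₀ h2]
  have h3 : (a + 2) * ((∑ n ∈ Finset.range N, ‖b n‖ ^ 2 * bV (a + 2) n) * (a + 2)) ≤
    (a + 2) * ((a + 1) * (∑ n ∈ Finset.range N, ‖b (n + 2) - b n‖ ^ 2 * bV a (n + 2) +
      ‖b 1‖ ^ 2 * bV a 1 + ‖b 0‖ ^ 2 * bV a 0)) := by linarith
  exact le_of_mul_le_mul_left h3 h2

lemma upper_ineq (a : ℝ) (ha : -1 < a) (φ : ℂ → ℂ)
    (hφ : DifferentiableOn ℂ φ (Metric.ball (0:ℂ) 1)) :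
    ∫⁻ z in Metric.ball (0 : ℂ) 1,
        ENNReal.ofReal (‖φ z / (1 - z ^ 2) / (1 - z ^ 2)‖ ^ 2 * (1 - ‖z‖ ^ 2) ^ (a + 4)) ≤
      ENNReal.ofReal ((a + 3) * (a + 1) / ((a + 4) * (a + 2))) *
        ∫⁻ z in Metric.ball (0 : ℂ) 1, ENNReal.ofReal (‖φ z‖ ^ 2 * (1 - ‖z‖ ^ 2) ^ a) := by
  have h1 := step_ineq a ha φ hφ
  have h2 := step_ineq (a + 2) (by linarith) _ (diff_div hφ)
  rw [show a + 2 + 2 = a + 4 by ring, show a + 2 + 1 = a + 3 by ring] at h2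
  refine h2.trans ((mul_le_mul_right h1 _).trans_eq ?_)
  have : 0 < a + 1 := by linarith
  have : 0 < a + 2 := by linarith
  have : 0 < a + 3 := by linarith
  have : 0 < a + 4 := by linarith
  rw [← mul_assoc, ← ENNReal.ofReal_mul (by positivity), div_mul_div_comm]

lemma aesm_bergman (a : ℝ) (φ : ℂ → ℂ) (hφ : ContinuousOn φ (Metric.ball (0:ℂ) 1)) :
    AEStronglyMeasurable (fun z : ℂ => ‖φ z‖ ^ 2 * (1 - ‖z‖ ^ 2) ^ a)
      (volume.restrict (Metric.ball (0:ℂ) 1)) := by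
  refine ContinuousOn.aestronglyMeasurable ?_ Metric.isOpen_ball.measurableSet
  refine (hφ.norm.pow 2).mul (ContinuousOn.rpow_const (by fun_prop) ?_)
  intro z hz
  left
  rw [mem_ball_zero_iff] at hz
  have : 0 < 1 - ‖z‖ ^ 2 := by nlinarith [norm_nonneg z]
  exact this.ne'

lemma nonneg_bergman (a : ℝ) (φ : ℂ → ℂ) :
    ∀ᵐ z ∂(volume.restrict (Metric.ball (0:ℂ) 1)), 0 ≤ ‖φ z‖ ^ 2 * (1 - ‖z‖ ^ 2) ^ a := by
  filter_upwards [ae_restrict_mem Metric.isOpen_ball.measurableSet] with z hz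
  rw [mem_ball_zero_iff] at hz
  have : 0 < 1 - ‖z‖ ^ 2 := by nlinarith [norm_nonneg z]
  positivity

lemma bergman_eq (a : ℝ) (φ : ℂ → ℂ) (hφ : ContinuousOn φ (Metric.ball (0:ℂ) 1)) :
    bergmanNormSq a φ = (a + 1) / π * (∫⁻ z in Metric.ball (0 : ℂ) 1,
      ENNReal.ofReal (‖φ z‖ ^ 2 * (1 - ‖z‖ ^ 2) ^ a)).toReal := by
  rw [bergmanNormSq, integral_eq_lintegral_of_nonneg_ae (nonneg_bergman a φ) (aesm_bergman a φ hφ)]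

lemma mem_iff_fin (a : ℝ) (φ : ℂ → ℂ) (hφ : ContinuousOn φ (Metric.ball (0:ℂ) 1)) :
    IntegrableOn (fun z : ℂ => ‖φ z‖ ^ 2 * (1 - ‖z‖ ^ 2) ^ a) (Metric.ball (0 : ℂ) 1) ↔
    ∫⁻ z in Metric.ball (0 : ℂ) 1,
      ENNReal.ofReal (‖φ z‖ ^ 2 * (1 - ‖z‖ ^ 2) ^ a) < ⊤ := by
  rw [IntegrableOn, Integrable, and_iff_right (aesm_bergman a φ hφ),
    hasFiniteIntegral_iff_ofReal (nonneg_bergman a φ)]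

/-- The target norm, in terms of the two-fold quotient. -/
lemma bergman_target (a : ℝ) (φ : ℂ → ℂ) (hφ : DifferentiableOn ℂ φ (Metric.ball (0:ℂ) 1)) :
    bergmanNormSq (a + 4) (fun z => (fun z : ℂ => -6 / (1 - z ^ 2) ^ 2) z * φ z) =
      36 * ((a + 5) / π * (∫⁻ z in Metric.ball (0 : ℂ) 1,
        ENNReal.ofReal (‖φ z / (1 - z ^ 2) / (1 - z ^ 2)‖ ^ 2 *
          (1 - ‖z‖ ^ 2) ^ (a + 4))).toReal) := by
  have h := bergman_eq (a + 4) _ (diff_div (diff_div hφ)).continuousOn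
  rw [show a + 4 + 1 = a + 5 by ring] at h
  rw [← h, bergmanNormSq, bergmanNormSq, mul_left_comm (36 : ℝ),
    ← integral_const_mul (36 : ℝ)]
  congr 1
  refine integral_congr_ae (Filter.Eventually.of_forall fun z => ?_)
  simp only
  rw [← mul_assoc]
  congr 1
  simp only [norm_mul, norm_div, norm_pow, norm_neg]
  rw [div_div, ← pow_two]
  simp only [div_pow, mul_pow]
  norm_num
  ring

lemma hasSum_quot {c : ℕ → ℂ} {φ : ℂ → ℂ}
    (hφ : ∀ z ∈ Metric.ball (0 : ℂ) 1, HasSum (fun n => c n * z ^ (2 * n)) (φ z)) :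
    ∀ z ∈ Metric.ball (0 : ℂ) 1,
      HasSum (fun n => (∑ k ∈ Finset.range (n + 1), c k) * z ^ (2 * n)) (φ z / (1 - z ^ 2)) := by
  intro z hz
  have h1 := hφ z hz
  rw [mem_ball_zero_iff] at hz
  have hz2 : ‖z ^ 2‖ < 1 := by rw [norm_pow]; nlinarith [norm_nonneg z]
  have hg := hasSum_geometric_of_norm_lt_one hz2
  have := hasSum_sum_range_mul_of_summable_norm h1.summable.norm hg.summable.norm
  rw [h1.tsum_eq, hg.tsum_eq, ← div_eq_mul_inv] at this
  suffices hfe : (fun n => (∑ k ∈ Finset.range (n + 1), c k) * z ^ (2 * n)) =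
      fun n => ∑ k ∈ Finset.range (n + 1), c k * z ^ (2 * k) * (z ^ 2) ^ (n - k) by
    rw [hfe]
    exact this
  funext n
  rw [Finset.sum_mul]
  refine Finset.sum_congr rfl fun k hk => ?_
  rw [mul_assoc, ← pow_mul, ← pow_add]
  congr 2
  have := Finset.mem_range.1 hk
  omega

/-- Binomial coefficients of `(1-u)^(-d)`. -/
noncomputable def bA (d : ℝ) : ℕ → ℝ
  | 0 => 1
  | (n + 1) => bA d n * ((d + n) / (n + 1))

lemma bA_succ (d : ℝ) (n : ℕ) : bA d (n + 1) = bA d n * ((d + n) / (n + 1)) := rfl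

lemma bA_pos (d : ℝ) (hd : 0 < d) (n : ℕ) : 0 < bA d n := by
  induction n with
  | zero => simp [bA]
  | succ n ih => rw [bA_succ]; positivity

lemma bA_shift (d : ℝ) (n : ℕ) : bA (d + 1) n * d = bA d n * (d + n) := by
  induction n with
  | zero => simp [bA]
  | succ n ih =>
    rw [bA_succ, bA_succ]
    have : (n:ℝ) + 1 ≠ 0 := by positivity
    push_cast
    field_simp
    linear_combination (d + 1 + n) * ih

lemma bA_sum (d : ℝ) (n : ℕ) : ∑ k ∈ Finset.range (n + 1), bA d k = bA (d + 1) n := by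
  induction n with
  | zero => simp [bA]
  | succ n ih =>
    rw [Finset.sum_range_succ, ih, bA_succ, bA_succ]
    have : (n:ℝ) + 1 ≠ 0 := by positivity
    have h := bA_shift d n
    field_simp
    linear_combination -h

/-- the terms of the source norm -/
noncomputable def tA (a : ℝ) (m : ℕ) : ℝ := bA ((a + 2) / 2) m ^ 2 * bV a (2 * m)

/-- the terms of the target norm -/
noncomputable def sA (a : ℝ) (m : ℕ) : ℝ := bA ((a + 2) / 2 + 1 + 1) m ^ 2 * bV (a + 4) (2 * m)

lemma tA_pos (a : ℝ) (ha : -1 < a) (m : ℕ) : 0 < tA a m := by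
  have := bA_pos ((a + 2) / 2) (by linarith) m
  have := bV_pos a ha (2 * m)
  unfold tA
  positivity

lemma sA_nonneg (a : ℝ) (ha : -1 < a) (m : ℕ) : 0 ≤ sA a m := by
  have := bV_pos (a + 4) (by linarith) (2 * m)
  unfold sA
  positivity

lemma sA_eq (a : ℝ) (ha : -1 < a) (m : ℕ) :
    sA a m = (a + 3) * (a + 1) / ((a + 4) * (a + 2)) *
      (((2 * m + a + 2) * (2 * m + a + 4)) / ((2 * m + a + 3) * (2 * m + a + 5))) * tA a m := by
  have hm : (0:ℝ) ≤ m := m.cast_nonneg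
  have h1 := bA_shift ((a + 2) / 2) m
  have h2 := bA_shift ((a + 2) / 2 + 1) m
  have h3 := bV_rel4 a ha (2 * m)
  have h4 := bV_rel4 (a + 2) (by linarith) (2 * m)
  rw [show a + 2 + 2 = a + 4 by ring] at h4
  push_cast at h3 h4
  have p1 : a + 1 ≠ 0 := by linarith
  have p2 : a + 2 ≠ 0 := by linarith
  have p4 : a + 4 ≠ 0 := by linarith
  have q2 : 2 * (m:ℝ) + a + 2 ≠ 0 := by linarith
  have q3 : 2 * (m:ℝ) + a + 3 ≠ 0 := by linarith
  have q4 : 2 * (m:ℝ) + a + 4 ≠ 0 := by linarith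
  have q5 : 2 * (m:ℝ) + a + 5 ≠ 0 := by linarith
  have e1 : bA ((a + 2) / 2 + 1) m = bA ((a + 2) / 2) m * (2 * m + a + 2) / (a + 2) := by
    rw [eq_div_iff p2]; linear_combination 2 * h1
  have e2 : bA ((a + 2) / 2 + 1 + 1) m =
      bA ((a + 2) / 2 + 1) m * (2 * m + a + 4) / (a + 4) := by
    rw [eq_div_iff p4]; linear_combination 2 * h2
  have e3 : bV (a + 2) (2 * m) =
      (a + 1) * (a + 2) * bV a (2 * m) / ((2 * m + a + 2) * (2 * m + a + 3)) := by
    rw [eq_div_iff (mul_ne_zero q2 q3)]; linear_combination h3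
  have e4 : bV (a + 4) (2 * m) =
      (a + 3) * (a + 4) * bV (a + 2) (2 * m) / ((2 * m + a + 4) * (2 * m + a + 5)) := by
    rw [eq_div_iff (mul_ne_zero q4 q5)]; linear_combination h4
  unfold sA tA
  rw [e2, e1, e4, e3]
  field_simp

lemma tA_diverges (a : ℝ) (ha : -1 < a) :
    Filter.Tendsto (fun n => ∑ i ∈ Finset.range n, tA a i) Filter.atTop Filter.atTop := by
  rw [← not_summable_iff_tendsto_nat_atTop_of_nonneg (fun n => (tA_pos a ha n).le)]
  intro hs
  have hrec : ∀ m : ℕ, tA a (m + 1) = tA a m *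
      (((2 * m + a + 2) * (2 * m + 1)) / ((2 * m + 2) * (2 * m + a + 3))) := by
    intro m
    have hm : (0:ℝ) ≤ m := m.cast_nonneg
    have q1 : (m:ℝ) + 1 ≠ 0 := by linarith
    have q2 : 2 * (m:ℝ) + a + 2 ≠ 0 := by linarith
    have q3 : 2 * (m:ℝ) + a + 3 ≠ 0 := by linarith
    have q4 : 2 * (m:ℝ) + 1 + a + 2 ≠ 0 := by linarith
    unfold tA
    rw [show 2 * (m + 1) = 2 * m + 1 + 1 by ring, bV_succ, bV_succ, bA_succ]
    push_cast
    field_simp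
    ring
  have hmon : ∀ m : ℕ, (m : ℝ) * tA a m ≤ (m + 1) * tA a (m + 1) := by
    intro m
    have hm : (0:ℝ) ≤ m := m.cast_nonneg
    rw [hrec]
    have q2 : 0 < (2 * (m:ℝ) + 2) * (2 * m + a + 3) := by
      apply mul_pos <;> linarith
    have : (m:ℝ) ≤ (m + 1) * (((2 * m + a + 2) * (2 * m + 1)) / ((2 * m + 2) * (2 * m + a + 3))) := by
      rw [mul_div_assoc', le_div_iff₀ q2]
      nlinarith
    calc (m : ℝ) * tA a m ≤ _ := mul_le_mul_of_nonneg_right this (tA_pos a ha m).le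
      _ = _ := by ring
  have hlow : ∀ m : ℕ, tA a 1 ≤ ((m:ℝ) + 1) * tA a (m + 1) := by
    intro m
    induction m with
    | zero => simp
    | succ m ih => refine ih.trans ?_; have := hmon (m + 1); push_cast at *; exact this
  have h2 : Summable fun m : ℕ => tA a 1 * (1 / ((m + 1 : ℕ) : ℝ)) := by
    refine Summable.of_nonneg_of_le (fun m => ?_) (fun m => ?_) ((summable_nat_add_iff 1).2 hs)
    · have := tA_pos a ha 1
      positivity
    · push_cast
      rw [mul_one_div, div_le_iff₀ (by positivity)]
      linarith [hlow m]
  rw [summable_mul_left_iff (tA_pos a ha 1).ne'] at h2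
  exact Real.not_summable_one_div_natCast ((summable_nat_add_iff 1).1 h2)

lemma ratio_limit (a : ℝ) (ha : -1 < a) (ε : ℝ) (hε : 0 < ε) :
    ∃ N, 0 < ∑ i ∈ Finset.range N, tA a i ∧
      ((a + 3) * (a + 1) / ((a + 4) * (a + 2)) - ε) * ∑ i ∈ Finset.range N, tA a i ≤
        ∑ i ∈ Finset.range N, sA a i := by
  set C := (a + 3) * (a + 1) / ((a + 4) * (a + 2)) with hC
  have hlim : Filter.Tendsto (fun m : ℕ => C *
      (((2 * m + a + 2) * (2 * m + a + 4)) / ((2 * m + a + 3) * (2 * m + a + 5))) - C)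
      Filter.atTop (nhds 0) := by
    have hb : ∀ x : ℝ, -1 < x → Filter.Tendsto (fun m : ℕ => (1:ℝ) / (2 * m + x + 1)) Filter.atTop (nhds 0) := by
      intro x hx
      refine Filter.Tendsto.div_atTop tendsto_const_nhds ?_
      refine Filter.tendsto_atTop_mono (f := fun m : ℕ => (m : ℝ)) (fun m => ?_) tendsto_natCast_atTop_atTop
      have hm : (0:ℝ) ≤ m := m.cast_nonneg
      linarith
    have h1 := (hb (a + 2) (by linarith)).const_sub 1
    have h2 := (hb (a + 4) (by linarith)).const_sub 1
    have h3 := ((h1.mul h2).const_mul C).sub_const C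
    simp only [sub_zero, mul_one, sub_self] at h3
    refine h3.congr fun m => ?_
    have hm : (0:ℝ) ≤ m := m.cast_nonneg
    have q3 : 2 * (m:ℝ) + a + 3 ≠ 0 := by linarith
    have q5 : 2 * (m:ℝ) + a + 5 ≠ 0 := by linarith
    have q3' : 2 * (m:ℝ) + (a + 2) + 1 ≠ 0 := by linarith
    have q5' : 2 * (m:ℝ) + (a + 4) + 1 ≠ 0 := by linarith
    field_simp
    ring
  have hlo : (fun m => sA a m - C * tA a m) =o[Filter.atTop] (tA a) := by
    have := Asymptotics.IsLittleO.mul_isBigO ((Asymptotics.isLittleO_one_iff ℝ).2 hlim)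
      (Asymptotics.isBigO_refl (tA a) Filter.atTop)
    simp only [one_mul] at this
    refine this.congr_left fun m => ?_
    rw [sA_eq a ha m]
    ring
  have hsum := hlo.sum_range (fun m => (tA_pos a ha m).le) (tA_diverges a ha)
  have hev := (hsum.def hε).and ((tA_diverges a ha).eventually_gt_atTop 0)
  obtain ⟨N, hN, hpos⟩ := hev.exists
  refine ⟨N, hpos, ?_⟩
  rw [Real.norm_eq_abs, Real.norm_eq_abs, abs_of_pos hpos, Finset.sum_sub_distrib,
    ← Finset.mul_sum] at hN
  have := (abs_le.1 hN).1
  linarith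

theorem multiplier_norm_schwarzian_koebe (α : ℝ) (hα : -1 < α) :
    multNormSq α (α + 4) (fun z : ℂ => -6 / (1 - z ^ 2) ^ 2) =
      36 * (α + 3) * (α + 5) / ((α + 2) * (α + 4)) := by
  have a1 : 0 < α + 1 := by linarith
  have a2 : 0 < α + 2 := by linarith
  have a3 : 0 < α + 3 := by linarith
  have a4 : 0 < α + 4 := by linarith
  have a5 : 0 < α + 5 := by linarith
  have hlower : ∀ w < 36 * (α + 3) * (α + 5) / ((α + 2) * (α + 4)),
      ∃ t ∈ {t : ℝ | ∃ φ : ℂ → ℂ, MemBergman α φ ∧ bergmanNormSq α φ ≠ 0 ∧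
        t = bergmanNormSq (α + 4) (fun z => (fun z : ℂ => -6 / (1 - z ^ 2) ^ 2) z * φ z) /
          bergmanNormSq α φ}, w < t := by
    intro w hw
    set K := 36 * (α + 3) * (α + 5) / ((α + 2) * (α + 4)) with hK
    set ε := (K - w) * (α + 1) / (36 * (α + 5)) / 2 with hε
    have hεpos : 0 < ε := by
      have : 0 < K - w := by linarith
      positivity
    obtain ⟨N, hT, hS⟩ := ratio_limit α hα ε hεpos
    set T := ∑ i ∈ Finset.range N, tA α i
    set S := ∑ i ∈ Finset.range N, sA α i
    let c : ℕ → ℂ := fun m => if m < N then ((bA ((α + 2) / 2) m : ℝ) : ℂ) else 0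
    let φ : ℂ → ℂ := fun z => ∑ m ∈ Finset.range N, c m * z ^ (2 * m)
    have hφd : DifferentiableOn ℂ φ (Metric.ball (0:ℂ) 1) := by
      have : Differentiable ℂ φ := by simp only [φ]; fun_prop
      exact this.differentiableOn
    have hφs : ∀ z ∈ Metric.ball (0 : ℂ) 1, HasSum (fun n => c n * z ^ (2 * n)) (φ z) := by
      intro z _
      refine hasSum_sum_of_ne_finset_zero ?_
      intro m hm
      have : ¬ m < N := fun h => hm (Finset.mem_range.2 h)
      simp [c, this]
    have hinj : Function.Injective (fun m : ℕ => 2 * m) := fun x y h => by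
      simp only at h; omega
    have hP := disc_parseval α hα c (fun m => 2 * m) hinj φ hφd.continuousOn hφs
    have hQ := disc_parseval (α + 4) (by linarith) _ (fun m => 2 * m) hinj _
      (diff_div (diff_div hφd)).continuousOn (hasSum_quot (hasSum_quot hφs))
    have hPT : ∫⁻ z in Metric.ball (0 : ℂ) 1, ENNReal.ofReal (‖φ z‖ ^ 2 * (1 - ‖z‖ ^ 2) ^ α) =
        ENNReal.ofReal (π * T) := by
      rw [hP, ENNReal.ofReal_mul Real.pi_pos.le, tsum_eq_sum (s := Finset.range N),
        ENNReal.ofReal_sum_of_nonneg (fun m _ => (tA_pos α hα m).le)]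
      · congr 1
        refine Finset.sum_congr rfl fun m hm => ?_
        simp only [c, if_pos (Finset.mem_range.1 hm), Complex.norm_real, Real.norm_eq_abs, sq_abs,
          tA]
      · intro m hm
        have : ¬ m < N := fun h => hm (Finset.mem_range.2 h)
        simp [c, this]
    have hQS : ENNReal.ofReal (π * S) ≤ ∫⁻ z in Metric.ball (0 : ℂ) 1,
        ENNReal.ofReal (‖φ z / (1 - z ^ 2) / (1 - z ^ 2)‖ ^ 2 *
          (1 - ‖z‖ ^ 2) ^ (α + 4)) := by
      rw [hQ, ENNReal.ofReal_mul Real.pi_pos.le]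
      gcongr
      refine le_trans (le_of_eq ?_) (ENNReal.sum_le_tsum (Finset.range N))
      rw [ENNReal.ofReal_sum_of_nonneg (fun m _ => (sA_nonneg α hα m))]
      refine Finset.sum_congr rfl fun m hm => ?_
      have hmN := Finset.mem_range.1 hm
      have hcs : ∀ j < N, ∑ k ∈ Finset.range (j + 1), c k =
          ((bA ((α + 2) / 2 + 1) j : ℝ) : ℂ) := by
        intro j hj
        rw [← bA_sum]
        push_cast
        refine Finset.sum_congr rfl fun k hk => ?_
        have : k < N := by have := Finset.mem_range.1 hk; omega
        simp only [c, if_pos this]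
      have hcc : ∑ j ∈ Finset.range (m + 1), ∑ k ∈ Finset.range (j + 1), c k =
          ((bA ((α + 2) / 2 + 1 + 1) m : ℝ) : ℂ) := by
        rw [← bA_sum]
        push_cast
        refine Finset.sum_congr rfl fun k hk => ?_
        exact hcs k (by have := Finset.mem_range.1 hk; omega)
      rw [hcc]
      simp only [Complex.norm_real, Real.norm_eq_abs, sq_abs, sA]
    have hmem : MemBergman α φ := by
      refine ⟨hφd, ?_⟩
      rw [mem_iff_fin α φ hφd.continuousOn, hPT]
      exact ENNReal.ofReal_lt_top
    have hn : bergmanNormSq α φ = (α + 1) * T := by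
      rw [bergman_eq α φ hφd.continuousOn, hPT, ENNReal.toReal_ofReal (by positivity)]
      field_simp
    have hnpos : 0 < bergmanNormSq α φ := by rw [hn]; positivity
    refine ⟨_, ⟨φ, hmem, hnpos.ne', rfl⟩, ?_⟩
    rw [bergman_target α φ hφd, hn]
    have hfin := (upper_ineq α hα φ hφd).trans_lt
      (ENNReal.mul_lt_top ENNReal.ofReal_lt_top (by rw [hPT]; exact ENNReal.ofReal_lt_top))
    have hS' : π * S ≤ (∫⁻ z in Metric.ball (0 : ℂ) 1,
        ENNReal.ofReal (‖φ z / (1 - z ^ 2) / (1 - z ^ 2)‖ ^ 2 *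
          (1 - ‖z‖ ^ 2) ^ (α + 4))).toReal := (ENNReal.ofReal_le_iff_le_toReal hfin.ne).1 hQS
    rw [lt_div_iff₀ (by positivity)]
    have hS2 : 36 * ((α + 5) / π * (π * S)) ≤ 36 * ((α + 5) / π *
      (∫⁻ z in Metric.ball (0 : ℂ) 1,
        ENNReal.ofReal (‖φ z / (1 - z ^ 2) / (1 - z ^ 2)‖ ^ 2 *
          (1 - ‖z‖ ^ 2) ^ (α + 4))).toReal) := by gcongr
    refine lt_of_lt_of_le ?_ hS2
    have e1 : 36 * ((α + 5) / π * (π * S)) = 36 * (α + 5) * S := by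
      field_simp
    rw [e1]
    have e2 : 36 * (α + 5) * (((α + 3) * (α + 1) / ((α + 4) * (α + 2)) - ε) * T) =
        (K - (K - w) / 2) * ((α + 1) * T) := by
      rw [hε, hK]
      field_simp
    have e3 := mul_le_mul_of_nonneg_left hS (show 0 ≤ 36 * (α + 5) by positivity)
    rw [e2] at e3
    refine lt_of_lt_of_le ?_ e3
    have : w < K - (K - w) / 2 := by linarith
    exact mul_lt_mul_of_pos_right this (by positivity)
  unfold multNormSq
  apply csSup_eq_of_forall_le_of_forall_lt_exists_gt
  · obtain ⟨t, ht, _⟩ := hlower _ (sub_one_lt _)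
    exact ⟨t, ht⟩
  · rintro t ⟨φ, ⟨hd, hi⟩, hne, rfl⟩
    rw [mem_iff_fin α φ hd.continuousOn] at hi
    have hup := upper_ineq α hα φ hd
    have hreal := ENNReal.toReal_mono (ENNReal.mul_lt_top ENNReal.ofReal_lt_top hi).ne hup
    rw [ENNReal.toReal_mul, ENNReal.toReal_ofReal (by positivity)] at hreal
    have hB := bergman_target α φ hd
    have hA := bergman_eq α φ hd.continuousOn
    have hpos : 0 < bergmanNormSq α φ := by
      refine lt_of_le_of_ne ?_ hne.symm
      rw [hA]
      positivity
    rw [div_le_iff₀ hpos]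
    refine hB.trans_le ?_
    rw [hA]
    calc _ ≤ 36 * ((α + 5) / π * ((α + 3) * (α + 1) / ((α + 4) * (α + 2)) *
          (∫⁻ z in Metric.ball (0 : ℂ) 1,
            ENNReal.ofReal (‖φ z‖ ^ 2 * (1 - ‖z‖ ^ 2) ^ α)).toReal)) := by gcongr
      _ = _ := by field_simp
  · exact hlower
end

section
/- Let α > -1 and let h̃ ∈ L²_α(ℝ₊), i.e., ∫_0^∞ |h̃(t)|² t^{-(α+1)} dt < ∞. Define h(w) = ∫_0^∞ h̃(t) e^{iwt} dt for w in the upper half-plane ℂ₊. Then h is analytic on ℂ₊ and (1/π) ∬_{ℂ₊} |h(u+iv)|² v^α du dv = (Γ(α+1)/2^α) ∫_0^∞ |h̃(t)|² t^{-(α+1)} dt. -/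
open MeasureTheory Complex Real
open scoped FourierTransform ENNReal ContDiff SchwartzMap

theorem four_continuous {f : ℝ → ℂ} (h1 : Integrable f) : Continuous (𝓕 f) :=
  VectorFourier.fourierIntegral_continuous Real.continuous_fourierChar
    (by exact continuous_inner (𝕜 := ℝ)) h1

theorem plancherel_aux (f : ℝ → ℂ) (h1 : Integrable f) (h2 : MemLp f 2) :
    ∫⁻ x, ‖𝓕 f x‖ₑ ^ 2 = ∫⁻ x, ‖f x‖ₑ ^ 2 := by
  have key : (𝓕 (h2.toLp f) : Lp ℂ 2 (volume : Measure ℝ)) =ᵐ[volume] 𝓕 f := by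
    apply ae_eq_of_integral_contDiff_smul_eq
    · exact (Lp.memLp _).locallyIntegrable (by norm_num)
    · exact (four_continuous h1).locallyIntegrable
    intro g gs gc
    have hg₁ : HasCompactSupport (Complex.ofRealCLM ∘ g) := gc.comp_left rfl
    have hg₂ : ContDiff ℝ ∞ (Complex.ofRealCLM ∘ g) := by fun_prop
    set G : 𝓢(ℝ, ℂ) := hg₁.toSchwartzMap hg₂ with hG
    have e1 := congrArg (fun T => T G) (Lp.fourier_toTemperedDistribution_eq (h2.toLp f))
    simp only [TemperedDistribution.fourier_apply, Lp.toTemperedDistribution_apply] at e1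
    have e2 : ∫ x, 𝓕 (G : ℝ → ℂ) x • f x = ∫ x, G x • 𝓕 f x := by
      simpa using! VectorFourier.integral_fourierIntegral_smul_eq_flip (L := innerₗ ℝ)
        Real.continuous_fourierChar continuous_inner G.integrable h1
    have e3 : ∫ x, (𝓕 G) x • (h2.toLp f) x = ∫ x, 𝓕 (G : ℝ → ℂ) x • f x := by
      apply integral_congr_ae
      filter_upwards [h2.coeFn_toLp] with x hx
      rw [hx, SchwartzMap.fourier_coe]
    rw [e3, e2] at e1
    simpa [hG] using e1.symm
  have n1 : eLpNorm (𝓕 f) 2 volume = eLpNorm f 2 volume := by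
    rw [← eLpNorm_congr_ae key, ← eLpNorm_congr_ae h2.coeFn_toLp]
    have := Lp.norm_fourier_eq (h2.toLp f)
    rw [Lp.norm_def, Lp.norm_def] at this
    exact (ENNReal.toReal_eq_toReal_iff' (Lp.eLpNorm_ne_top _) (Lp.eLpNorm_ne_top _)).1 this
  have n2 := fun (g : ℝ → ℂ) => eLpNorm_nnreal_pow_eq_lintegral (f := g) (μ := volume) (p := 2) (by norm_num)
  have a := n2 f
  have b := n2 (𝓕 f)
  simp only [ENNReal.coe_ofNat, NNReal.coe_ofNat, ENNReal.rpow_ofNat] at a b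
  rw [← a, ← b, n1]

theorem rpow_exp_integrable {s b : ℝ} (hs : -1 < s) (hb : 0 < b) :
    IntegrableOn (fun t : ℝ => t ^ s * rexp (-(b * t))) (Set.Ioi 0) := by
  have := integrableOn_rpow_mul_exp_neg_mul_rpow (p := 1) hs one_pos hb
  simpa [neg_mul] using this

theorem gamma_lint {α r : ℝ} (hα : -1 < α) (hr : 0 < r) :
    ∫⁻ v in Set.Ioi (0 : ℝ), ENNReal.ofReal (v ^ α * rexp (-(r * v))) =
      ENNReal.ofReal ((1 / r) ^ (α + 1) * Real.Gamma (α + 1)) := by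
  rw [← Real.integral_rpow_mul_exp_neg_mul_Ioi (by linarith) hr,
    ofReal_integral_eq_lintegral_ofReal]
  · simp
  · simpa [IntegrableOn] using rpow_exp_integrable hα hr
  · filter_upwards [ae_restrict_mem measurableSet_Ioi] with t ht
    have : (0 : ℝ) < t := ht
    simp only [Pi.zero_apply]
    positivity

theorem rpow_exp_bdd {a c : ℝ} (ha : 0 < a) (hc : 0 < c) :
    ∃ C : ℝ, ∀ t : ℝ, 0 < t → t ^ a * rexp (-(c * t)) ≤ C := by
  refine ⟨rexp (-a + a * Real.log (a / c)), fun t ht => ?_⟩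
  rw [Real.rpow_def_of_pos ht, ← Real.exp_add]
  apply Real.exp_le_exp.2
  have h1 := Real.log_le_sub_one_of_pos (show 0 < t / (a / c) by positivity)
  rw [Real.log_div ht.ne' (by positivity)] at h1
  have h2 : a * (Real.log t - Real.log (a / c)) ≤ a * (t / (a / c) - 1) :=
    mul_le_mul_of_nonneg_left h1 ha.le
  have h3 : a * (t / (a / c) - 1) = c * t - a := by field_simp
  nlinarith

section
variable {α : ℝ} {g : ℝ → ℂ}

theorem int_exp (hα : -1 < α) (hm : Measurable g)
    (hi : IntegrableOn (fun t : ℝ => ‖g t‖ ^ 2 * t ^ (-(α + 1))) (Set.Ioi (0 : ℝ)))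
    {v : ℝ} (hv : 0 < v) (k : ℕ) :
    IntegrableOn (fun t : ℝ => t ^ k * (‖g t‖ * rexp (-(v * t)))) (Set.Ioi 0) := by
  have h2 := rpow_exp_integrable (s := 2 * k + α + 1) (b := 2 * v)
    (by have : (0:ℝ) ≤ k := k.cast_nonneg
        linarith) (by linarith)
  refine Integrable.mono' (hi.add h2) (by fun_prop) ?_
  filter_upwards [ae_restrict_mem measurableSet_Ioi] with t ht
  have ht : (0 : ℝ) < t := ht
  simp only [Pi.add_apply]
  rw [Real.norm_of_nonneg (by positivity)]
  set p := t ^ (-(α + 1) / 2) with hp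
  set q := t ^ ((α + 1) / 2) with hq
  have pq : p * q = 1 := by
    rw [hp, hq, ← Real.rpow_add ht]; ring_nf; simp
  have pp : t ^ (-(α + 1)) = p ^ 2 := by
    rw [hp, ← Real.rpow_mul_natCast ht.le]; congr 1; push_cast; ring
  have qq : t ^ (2 * k + α + 1) = (t ^ k * q) ^ 2 := by
    rw [hq, ← Real.rpow_natCast t k, ← Real.rpow_add ht, ← Real.rpow_mul_natCast ht.le]
    congr 1; push_cast; ring
  have ee : rexp (-(2 * v * t)) = rexp (-(v * t)) ^ 2 := by
    rw [← Real.exp_nat_mul]; congr 1; push_cast; ring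
  rw [pp, qq, ee]
  have : t ^ k * (‖g t‖ * rexp (-(v * t))) = (‖g t‖ * p) * (t ^ k * q * rexp (-(v * t))) := by
    linear_combination (-(t ^ k * (‖g t‖ * rexp (-(v * t))))) * pq
  rw [this]
  nlinarith [sq_nonneg (‖g t‖ * p - t ^ k * q * rexp (-(v * t))), sq_nonneg (‖g t‖ * p), sq_nonneg (t ^ k * q * rexp (-(v * t)))]

theorem int_sq (hα : -1 < α) (hm : Measurable g)
    (hi : IntegrableOn (fun t : ℝ => ‖g t‖ ^ 2 * t ^ (-(α + 1))) (Set.Ioi (0 : ℝ)))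
    {v : ℝ} (hv : 0 < v) :
    IntegrableOn (fun t : ℝ => ‖g t‖ ^ 2 * rexp (-(2 * v * t))) (Set.Ioi 0) := by
  obtain ⟨C, hC⟩ := rpow_exp_bdd (a := α + 1) (c := 2 * v) (by linarith) (by linarith)
  refine Integrable.mono' (hi.mul_const C) (by fun_prop) ?_
  filter_upwards [ae_restrict_mem measurableSet_Ioi] with t ht
  have ht : (0 : ℝ) < t := ht
  rw [Real.norm_of_nonneg (by positivity)]
  have e : t ^ (-(α + 1)) * t ^ (α + 1) = 1 := by rw [← Real.rpow_add ht]; simp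
  calc _ = ‖g t‖ ^ 2 * t ^ (-(α + 1)) * (t ^ (α + 1) * rexp (-(2 * v * t))) := by
        linear_combination (-(‖g t‖ ^ 2 * rexp (-(2 * v * t)))) * e
    _ ≤ _ := mul_le_mul_of_nonneg_left (hC t ht) (by positivity)

theorem norm_cexp (w : ℂ) (t : ℝ) : ‖cexp (I * w * t)‖ = rexp (-(w.im * t)) := by
  rw [Complex.norm_exp]; simp

theorem diff_h (hα : -1 < α) (hm : Measurable g)
    (hi : IntegrableOn (fun t : ℝ => ‖g t‖ ^ 2 * t ^ (-(α + 1))) (Set.Ioi (0 : ℝ)))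
    {w : ℂ} (hw : 0 < w.im) :
    DifferentiableAt ℂ (fun w : ℂ => ∫ t in Set.Ioi (0 : ℝ), g t * cexp (I * w * t)) w := by
  have hs : {z : ℂ | w.im / 2 < z.im} ∈ nhds w :=
    (isOpen_lt continuous_const Complex.continuous_im).mem_nhds (by simp; linarith)
  have := hasDerivAt_integral_of_dominated_loc_of_deriv_le
    (μ := volume.restrict (Set.Ioi (0 : ℝ))) (𝕜 := ℂ)
    (F := fun w t => g t * cexp (I * w * t))
    (F' := fun w t => g t * (cexp (I * w * t) * (I * t)))
    (bound := fun t => t ^ 1 * (‖g t‖ * rexp (-(w.im / 2 * t)))) hs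
    (Filter.Eventually.of_forall fun z => by fun_prop) ?_ (by fun_prop) ?_
    (int_exp hα hm hi (by linarith) 1) ?_
  · exact this.2.differentiableAt
  · have := int_exp hα hm hi hw 0
    refine Integrable.mono' this (by fun_prop) ?_
    refine Filter.Eventually.of_forall fun t => ?_
    rw [norm_mul, norm_cexp]; simp
  · filter_upwards [ae_restrict_mem measurableSet_Ioi] with t ht z hz
    have ht : (0 : ℝ) < t := ht
    have hz : w.im / 2 < z.im := hz
    rw [norm_mul, norm_mul, norm_cexp]
    simp only [norm_mul, norm_I, one_mul, norm_real, Real.norm_of_nonneg ht.le, pow_one]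
    have : rexp (-(z.im * t)) ≤ rexp (-(w.im / 2 * t)) := by
      apply Real.exp_le_exp.2; nlinarith
    calc _ = t * (‖g t‖ * rexp (-(z.im * t))) := by ring
      _ ≤ _ := by gcongr
  · refine Filter.Eventually.of_forall fun t z _ => ?_
    have h1 : HasDerivAt (fun z : ℂ => I * z * t) (I * t) z := by
      simpa using ((hasDerivAt_id z).const_mul I).mul_const (t : ℂ)
    exact h1.cexp.const_mul (g t)

theorem slice (hα : -1 < α) (hm : Measurable g)
    (hi : IntegrableOn (fun t : ℝ => ‖g t‖ ^ 2 * t ^ (-(α + 1))) (Set.Ioi (0 : ℝ)))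
    {v : ℝ} (hv : 0 < v) :
    ∫⁻ u : ℝ, ‖∫ t in Set.Ioi (0 : ℝ), g t * cexp (I * (u + v * I) * t)‖ₑ ^ 2 =
      ENNReal.ofReal (2 * π) *
        ∫⁻ t in Set.Ioi (0 : ℝ), ENNReal.ofReal (‖g t‖ ^ 2 * rexp (-(2 * v * t))) := by
  set f : ℝ → ℂ := (Set.Ioi (0 : ℝ)).indicator (fun t => g t * rexp (-(v * t))) with hf
  have hfm : Measurable f := Measurable.indicator (by fun_prop) measurableSet_Ioi
  have h1 : Integrable f := by
    rw [hf, integrable_indicator_iff measurableSet_Ioi]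
    refine Integrable.mono' (int_exp hα hm hi hv 0) (by fun_prop) ?_
    refine Filter.Eventually.of_forall fun t => ?_
    rw [norm_mul, norm_real, Real.norm_of_nonneg (Real.exp_pos _).le]; simp
  have sq : ∀ t, ‖g t * rexp (-(v * t))‖ ^ 2 = ‖g t‖ ^ 2 * rexp (-(2 * v * t)) := by
    intro t
    rw [norm_mul, norm_real, Real.norm_of_nonneg (Real.exp_pos _).le, mul_pow,
      ← Real.exp_nat_mul]
    congr 2; push_cast; ring
  have h2 : MemLp f 2 := by
    rw [hf, memLp_indicator_iff_restrict measurableSet_Ioi,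
      memLp_two_iff_integrable_sq_norm (by fun_prop)]
    simp_rw [sq]
    exact int_sq hα hm hi hv
  have e : ∀ u : ℝ, ∫ t in Set.Ioi (0 : ℝ), g t * cexp (I * (u + v * I) * t) =
      𝓕 f ((-(2 * π)⁻¹) * u) := by
    intro u
    rw [Real.fourier_real_eq_integral_exp_smul, ← integral_indicator measurableSet_Ioi]
    congr 1
    ext t
    by_cases ht : t ∈ Set.Ioi (0 : ℝ)
    · simp only [hf, Set.indicator_of_mem ht, smul_eq_mul]
      rw [mul_left_comm, ofReal_exp, ← Complex.exp_add]
      congr 2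
      have : (π : ℂ) ≠ 0 := by exact_mod_cast Real.pi_ne_zero
      push_cast
      field_simp
      linear_combination (v * t : ℂ) * I_sq
    · simp [hf, Set.indicator_of_notMem ht]
  simp_rw [e]
  have hc : (-(2 * π)⁻¹ : ℝ) ≠ 0 := by simp [Real.pi_ne_zero]
  have sc : ∫⁻ u : ℝ, ‖𝓕 f ((-(2 * π)⁻¹) * u)‖ₑ ^ 2 =
      ENNReal.ofReal (2 * π) * ∫⁻ u, ‖𝓕 f u‖ₑ ^ 2 := by
    rw [← lintegral_map (f := fun x => ‖𝓕 f x‖ₑ ^ 2) (g := fun u : ℝ => (-(2 * π)⁻¹) * u)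
      (by have := (four_continuous h1).measurable
          fun_prop) (by fun_prop), Real.map_volume_mul_left hc, lintegral_smul_measure]
    have : |(-(2 * π)⁻¹ : ℝ)⁻¹| = 2 * π := by
      rw [inv_neg, inv_inv, abs_neg, abs_of_pos (by positivity)]
    rw [this, smul_eq_mul]
  rw [sc, plancherel_aux f h1 h2, ← lintegral_indicator measurableSet_Ioi]
  congr 2
  ext t
  by_cases ht : t ∈ Set.Ioi (0 : ℝ)
  · simp only [hf, Set.indicator_of_mem ht]
    rw [← sq, ENNReal.ofReal_pow (norm_nonneg _), ofReal_norm]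
  · simp [hf, Set.indicator_of_notMem ht]
end

theorem paley_wiener_bergman_half_plane (α : ℝ) (hα : -1 < α) (htil : ℝ → ℂ)
    (hmeas : Measurable htil)
    (hint : IntegrableOn (fun t : ℝ => ‖htil t‖ ^ 2 * t ^ (-(α + 1))) (Set.Ioi (0 : ℝ)))
    (h : ℂ → ℂ)
    (hdef : ∀ w : ℂ, 0 < w.im →
      h w = ∫ t in Set.Ioi (0 : ℝ), htil t * Complex.exp (Complex.I * w * t)) :
    DifferentiableOn ℂ h {w : ℂ | 0 < w.im} ∧
      (1 / π) * ∫ w in {w : ℂ | 0 < w.im}, ‖h w‖ ^ 2 * w.im ^ α =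
        Real.Gamma (α + 1) / 2 ^ α *
          ∫ t in Set.Ioi (0 : ℝ), ‖htil t‖ ^ 2 * t ^ (-(α + 1)) := by
  have hdiff : DifferentiableOn ℂ h {w : ℂ | 0 < w.im} := by
    intro w hw
    refine (diff_h hα hmeas hint hw).differentiableWithinAt.congr (fun z hz => hdef z hz)
      (hdef w hw)
  refine ⟨hdiff, ?_⟩
  have hms : MeasurableSet {w : ℂ | 0 < w.im} :=
    (isOpen_lt continuous_const Complex.continuous_im).measurableSet
  have hAE : AEMeasurable h (volume.restrict {w : ℂ | 0 < w.im}) :=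
    hdiff.continuousOn.aemeasurable hms
  have hG : AEMeasurable (fun w : ℂ => ENNReal.ofReal (‖h w‖ ^ 2 * w.im ^ α))
      (volume.restrict {w : ℂ | 0 < w.im}) := by
    have := Complex.measurable_im
    fun_prop
  have hL : ∫⁻ w in {w : ℂ | 0 < w.im}, ENNReal.ofReal (‖h w‖ ^ 2 * w.im ^ α) =
      ENNReal.ofReal (π * (Real.Gamma (α + 1) / 2 ^ α)) *
        ∫⁻ t in Set.Ioi (0 : ℝ), ENNReal.ofReal (‖htil t‖ ^ 2 * t ^ (-(α + 1))) := by
    have mp := Complex.volume_preserving_equiv_real_prod.symm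
    have me := Complex.measurableEquivRealProd.symm.measurableEmbedding
    have hpre : (Complex.measurableEquivRealProd.symm ⁻¹' {w : ℂ | 0 < w.im}) =
        Set.univ ×ˢ Set.Ioi (0 : ℝ) := by
      ext p; simp [Complex.measurableEquivRealProd_symm_apply]
    rw [← mp.setLIntegral_comp_preimage_emb me, hpre]
    have hG' : AEMeasurable (fun p : ℝ × ℝ => ENNReal.ofReal
        (‖h (Complex.measurableEquivRealProd.symm p)‖ ^ 2 *
          (Complex.measurableEquivRealProd.symm p).im ^ α))
        ((volume : Measure ℝ).prod (volume.restrict (Set.Ioi (0 : ℝ)))) := by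
      have := hG.comp_quasiMeasurePreserving
        (mp.restrict_preimage_emb me {w : ℂ | 0 < w.im}).quasiMeasurePreserving
      rw [hpre, Measure.volume_eq_prod, ← Measure.prod_restrict, Measure.restrict_univ] at this
      exact this
    rw [Measure.volume_eq_prod, ← Measure.prod_restrict, Measure.restrict_univ,
      lintegral_prod_symm _ hG']
    have step : ∀ v ∈ Set.Ioi (0 : ℝ), ∫⁻ u : ℝ, ENNReal.ofReal
        (‖h (Complex.measurableEquivRealProd.symm (u, v))‖ ^ 2 *
          (Complex.measurableEquivRealProd.symm (u, v)).im ^ α) =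
        ∫⁻ t in Set.Ioi (0 : ℝ), ENNReal.ofReal (2 * π) *
          (ENNReal.ofReal (‖htil t‖ ^ 2) * ENNReal.ofReal (v ^ α * rexp (-(2 * t * v)))) := by
      intro v hv
      have hv : (0 : ℝ) < v := hv
      have e1 : ∀ u : ℝ, ENNReal.ofReal
        (‖h (Complex.measurableEquivRealProd.symm (u, v))‖ ^ 2 *
          (Complex.measurableEquivRealProd.symm (u, v)).im ^ α) =
          ‖∫ t in Set.Ioi (0 : ℝ), htil t * cexp (I * (u + v * I) * t)‖ₑ ^ 2 *
            ENNReal.ofReal (v ^ α) := by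
        intro u
        have : Complex.measurableEquivRealProd.symm (u, v) = u + v * I := by
          apply Complex.ext <;> simp [Complex.measurableEquivRealProd_symm_apply]
        rw [this, hdef _ (by simpa using hv), ENNReal.ofReal_mul (by positivity),
          ENNReal.ofReal_pow (norm_nonneg _), ofReal_norm]
        simp
      simp_rw [e1]
      rw [lintegral_mul_const' _ _ ENNReal.ofReal_ne_top, slice hα hmeas hint hv,
        lintegral_const_mul' _ _ ENNReal.ofReal_ne_top, mul_assoc,
        ← lintegral_mul_const' _ _ ENNReal.ofReal_ne_top]
      congr 1
      apply lintegral_congr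
      intro t
      rw [← ENNReal.ofReal_mul (by positivity), ← ENNReal.ofReal_mul (by positivity)]
      congr 1
      rw [show 2 * v * t = 2 * t * v by ring]; ring
    rw [setLIntegral_congr_fun measurableSet_Ioi step, lintegral_lintegral_swap
      (by simp only [Function.uncurry_def]; fun_prop),
      ← lintegral_const_mul' _ _ ENNReal.ofReal_ne_top]
    apply setLIntegral_congr_fun measurableSet_Ioi
    intro t ht
    have ht : (0 : ℝ) < t := ht
    have hΓ : 0 < Real.Gamma (α + 1) := Real.Gamma_pos_of_pos (by linarith)
    beta_reduce
    rw [lintegral_const_mul' _ _ ENNReal.ofReal_ne_top,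
      lintegral_const_mul' _ _ ENNReal.ofReal_ne_top, gamma_lint hα (by positivity),
      ← ENNReal.ofReal_mul (by positivity), ← ENNReal.ofReal_mul (by positivity),
      ← ENNReal.ofReal_mul (by positivity)]
    congr 1
    rw [one_div, ← Real.rpow_neg_one, ← Real.rpow_mul (by positivity),
      Real.mul_rpow (by positivity) ht.le, neg_one_mul, Real.rpow_neg (by positivity : (0:ℝ) ≤ 2),
      Real.rpow_add two_pos, Real.rpow_one]
    field_simp
  have hae : AEStronglyMeasurable (fun w : ℂ => ‖h w‖ ^ 2 * w.im ^ α)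
      (volume.restrict {w : ℂ | 0 < w.im}) := by
    apply AEMeasurable.aestronglyMeasurable
    have := Complex.measurable_im
    fun_prop
  rw [integral_eq_lintegral_of_nonneg_ae _ hae, integral_eq_lintegral_of_nonneg_ae _ hint.1, hL,
    ENNReal.toReal_mul, ENNReal.toReal_ofReal]
  · have := Real.pi_ne_zero
    field_simp
  · have hΓ : 0 < Real.Gamma (α + 1) := Real.Gamma_pos_of_pos (by linarith)
    positivity
  · filter_upwards [ae_restrict_mem measurableSet_Ioi] with t ht
    have ht : (0 : ℝ) < t := ht
    simp only [Pi.zero_apply]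
    positivity
  · filter_upwards [ae_restrict_mem hms] with w hw
    have hw : (0 : ℝ) < w.im := hw
    simp only [Pi.zero_apply]
    positivity
end
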